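/- Let k be an algebraically closed field and let S = V(f) ⊆ P³ be a smooth surface of degree d > 3 containing exactly d²(d²−3d+3) lines. Then for any two skew lines L and M on S (distinct lines with L ∩ M = 0), the set of lines on S meeting both L and M has cardinality exactly (d−1)²+1. -/

import Mathlib

open MvPolynomial

/-- `W` is a line (2-dimensional linear subspace of `k⁴`) lying on the surface `V(f) ⊆ P³`. -/
def IsLineOn {k : Type*} [Field k] (f : MvPolynomial (Fin 4) k)
    (W : Submodule k (Fin 4 → k)) : Prop :=
  Module.finrank k W = 2 ∧ ∀ v ∈ W, MvPolynomial.eval v f = 0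

/-- `f` is a nonzero homogeneous polynomial of degree `d` in `k[x,y,z,w]` such that `f` and its
four partial derivatives have no common zero in `k⁴ ∖ {0}`; i.e. `V(f) ⊆ P³` is a smooth
surface of degree `d`. -/
def IsSmoothSurface {k : Type*} [Field k] (f : MvPolynomial (Fin 4) k) (d : ℕ) : Prop :=
  f ≠ 0 ∧ f.IsHomogeneous d ∧
    ∀ v : Fin 4 → k, v ≠ 0 →
      ¬ (MvPolynomial.eval v f = 0 ∧
         ∀ i : Fin 4, MvPolynomial.eval v (MvPolynomial.pderiv i f) = 0)

section Bezout

variable {k : Type*} [Field k] {n : ℕ}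

/-- Modulo an ideal with finite zero locus, every polynomial has a representative of bounded
degree. -/
theorem exists_bounded_representatives [IsAlgClosed k] (I : Ideal (MvPolynomial (Fin n) k))
    (Z : Finset (Fin n → k)) (hZ : zeroLocus k I ⊆ Z) :
    ∃ c : ℕ, ∀ p, ∃ r ∈ restrictTotalDegree (Fin n) k c, p - r ∈ I := by
  have hX : ∀ i, IsIntegral k (Ideal.Quotient.mk I (X i)) := by
    intro i
    have h1 : (∏ P ∈ Z, (X i - C (P i)) : MvPolynomial (Fin n) k) ∈ I.radical := by
      rw [← vanishingIdeal_zeroLocus_eq_radical (K := k) I, mem_vanishingIdeal_iff]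
      intro x hx
      rw [map_prod]
      exact Finset.prod_eq_zero (hZ hx) (by simp)
    obtain ⟨e, he⟩ := h1
    refine ⟨(∏ P ∈ Z, (Polynomial.X - Polynomial.C (P i))) ^ e,
      (Polynomial.monic_prod_of_monic _ _ fun P _ => Polynomial.monic_X_sub_C _).pow e, ?_⟩
    have := Ideal.Quotient.eq_zero_iff_mem.2 he
    simp only [map_pow, map_prod, map_sub] at this
    rw [Polynomial.eval₂_pow, Polynomial.eval₂_finsetProd]
    simp only [Polynomial.eval₂_sub, Polynomial.eval₂_X, Polynomial.eval₂_C]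
    exact this
  have hint : Algebra.IsIntegral k (MvPolynomial (Fin n) k ⧸ I) := by
    refine ⟨fun x => ?_⟩
    obtain ⟨p, rfl⟩ := Ideal.Quotient.mk_surjective x
    induction p using MvPolynomial.induction_on with
    | C a => exact isIntegral_algebraMap (A := MvPolynomial (Fin n) k ⧸ I) (x := a)
    | add p q hp hq => simpa using hp.add hq
    | mul_X p i hp => simpa using hp.mul (hX i)
  have hfin : Module.Finite k (MvPolynomial (Fin n) k ⧸ I) := Algebra.IsIntegral.finite
  obtain ⟨N, v, hv⟩ := Module.Finite.exists_fin (R := k) (M := MvPolynomial (Fin n) k ⧸ I)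
  choose g hg using fun j => Ideal.Quotient.mk_surjective (v j)
  refine ⟨Finset.univ.sup fun j => (g j).totalDegree, fun p => ?_⟩
  have hp : Ideal.Quotient.mk I p ∈ Submodule.span k (Set.range v) := by rw [hv]; trivial
  obtain ⟨a, ha⟩ := (Submodule.mem_span_range_iff_exists_fun k).1 hp
  refine ⟨∑ j, a j • g j, Submodule.sum_mem _ fun j _ => Submodule.smul_mem _ _ ?_, ?_⟩
  · rw [mem_restrictTotalDegree]
    exact Finset.le_sup (f := fun j => (g j).totalDegree) (Finset.mem_univ j)
  · rw [← Ideal.Quotient.eq, ← ha, map_sum]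
    refine Finset.sum_congr rfl fun j _ => ?_
    rw [← hg j]
    exact (map_smul (Ideal.Quotient.mkₐ k I) (a j) (g j)).symm

theorem mul_mem_restrictTotalDegree {a b : ℕ} {p q : MvPolynomial (Fin n) k}
    (hp : p ∈ restrictTotalDegree (Fin n) k a) (hq : q ∈ restrictTotalDegree (Fin n) k b) :
    p * q ∈ restrictTotalDegree (Fin n) k (a + b) := by
  rw [mem_restrictTotalDegree] at *
  exact (totalDegree_mul p q).trans (add_le_add hp hq)

theorem restrictTotalDegree_mono {a b : ℕ} (h : a ≤ b) {p : MvPolynomial (Fin n) k}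
    (hp : p ∈ restrictTotalDegree (Fin n) k a) : p ∈ restrictTotalDegree (Fin n) k b := by
  rw [mem_restrictTotalDegree] at *
  exact hp.trans h

/-- Degree control of representatives modulo powers of an ideal generated in degree at most `q`. -/
theorem exists_bounded_representatives_pow {ι : Type*} (F : ι → MvPolynomial (Fin n) k) {q c : ℕ}
    (hF : ∀ i, F i ∈ restrictTotalDegree (Fin n) k q)
    (hc : ∀ p, ∃ r ∈ restrictTotalDegree (Fin n) k c, p - r ∈ Ideal.span (Set.range F)) (m : ℕ) :
    ∀ p, ∃ r ∈ restrictTotalDegree (Fin n) k (q * m + c),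
      p - r ∈ Ideal.span (Set.range F) ^ (m + 1) := by
  set I := Ideal.span (Set.range F) with hI
  have key : ∀ m, ∀ y ∈ I ^ m, ∃ r ∈ restrictTotalDegree (Fin n) k (q * m + c),
      y - r ∈ I ^ (m + 1) := by
    intro m
    induction m with
    | zero => intro y _; simpa using hc y
    | succ m ih =>
      have hspan : ∀ a ∈ I, ∀ b ∈ I ^ m,
          ∃ r ∈ restrictTotalDegree (Fin n) k (q * (m + 1) + c), a * b - r ∈ I ^ (m + 2) := by
        intro a ha
        induction ha using Submodule.span_induction with
        | mem a ha =>
          obtain ⟨i, rfl⟩ := ha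
          intro b hb
          obtain ⟨r, hr, hbr⟩ := ih b hb
          refine ⟨F i * r, ?_, ?_⟩
          · have := mul_mem_restrictTotalDegree (hF i) hr
            rwa [show q * (m + 1) + c = q + (q * m + c) by ring]
          · rw [← mul_sub, pow_succ' I]
            exact Ideal.mul_mem_mul (Ideal.subset_span ⟨i, rfl⟩) hbr
        | zero => intro b _; exact ⟨0, zero_mem _, by simp⟩
        | add x y _ _ hx hy =>
          intro b hb
          obtain ⟨r, hr, hr'⟩ := hx b hb
          obtain ⟨s, hs, hs'⟩ := hy b hb
          refine ⟨r + s, add_mem hr hs, ?_⟩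
          have := add_mem hr' hs'
          rwa [show (x + y) * b - (r + s) = x * b - r + (y * b - s) by ring]
        | smul u x _ hx =>
          intro b hb
          obtain ⟨r, hr, hr'⟩ := hx (u * b) (Ideal.mul_mem_left _ _ hb)
          refine ⟨r, hr, ?_⟩
          rwa [smul_eq_mul, show u * x * b = x * (u * b) by ring]
      intro y hy
      rw [pow_succ'] at hy
      induction hy using Submodule.mul_induction_on' with
      | mem_mul_mem a ha b hb => exact hspan a ha b hb
      | add x _ y _ hx hy =>
        obtain ⟨r, hr, hr'⟩ := hx
        obtain ⟨s, hs, hs'⟩ := hy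
        refine ⟨r + s, add_mem hr hs, ?_⟩
        have := add_mem hr' hs'
        rwa [show x + y - (r + s) = x - r + (y - s) by ring]
  induction m with
  | zero => intro p; simpa using hc p
  | succ m ih =>
    intro p
    obtain ⟨r, hr, hpr⟩ := ih p
    obtain ⟨s, hs, hs'⟩ := key (m + 1) _ hpr
    refine ⟨r + s, add_mem (restrictTotalDegree_mono ?_ hr) hs, ?_⟩
    · gcongr; omega
    · rwa [show p - (r + s) = p - r - s by ring]

theorem card_degree_eq (n N : ℕ) :
    {s : Fin n →₀ ℕ | s.degree = N}.ncard = n.multichoose N := by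
  have : {s : Fin n →₀ ℕ | s.degree = N} = (Finset.univ.finsuppAntidiag N : Finset (Fin n →₀ ℕ)) := by
    ext s
    simp [Finset.mem_finsuppAntidiag, Finsupp.degree_eq_sum]
  rw [this, Set.ncard_coe_finset, Finset.card_finsuppAntidiag_nat_eq_multichoose]
  simp

theorem finite_degree_le (n N : ℕ) : {s : Fin n →₀ ℕ | s.degree ≤ N}.Finite := by
  refine Set.Finite.subset (Finset.finite_toSet ((Finset.range (N + 1)).biUnion fun j =>
    (Finset.univ.finsuppAntidiag j : Finset (Fin n →₀ ℕ)))) fun s hs => ?_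
  simp only [Finset.coe_biUnion, Finset.mem_coe, Set.mem_iUnion]
  exact ⟨s.degree, by simpa using Nat.lt_succ_of_le hs, by
    simp [Finset.mem_finsuppAntidiag, Finsupp.degree_eq_sum]⟩

theorem card_degree_le (n N : ℕ) :
    {s : Fin n →₀ ℕ | s.degree ≤ N}.ncard = (N + n).choose n := by
  have hmc : {s : Fin n →₀ ℕ | s.degree ≤ N}.ncard = (n + 1).multichoose N := by
    induction N with
    | zero =>
      have : {s : Fin n →₀ ℕ | s.degree ≤ 0} = {0} := by
        ext s; simp [Finsupp.degree_eq_zero_iff]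
      rw [this, Set.ncard_singleton, Nat.multichoose_zero_right]
    | succ N ih =>
      have : {s : Fin n →₀ ℕ | s.degree ≤ N + 1} =
          {s | s.degree = N + 1} ∪ {s | s.degree ≤ N} := by
        ext s; simp only [Set.mem_ofPred_eq, Set.mem_union]; omega
      rw [this, Set.ncard_union_eq ?_ ?_ (finite_degree_le n N), ih, card_degree_eq,
        Nat.multichoose_succ_succ]
      · rw [Set.disjoint_left]
        intro s h1 h2
        simp only [Set.mem_ofPred_eq] at h1 h2
        omega
      · exact (finite_degree_le n (N + 1)).subset fun s hs => le_of_eq hs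
  rw [hmc, Nat.multichoose_eq, show n + 1 + N - 1 = N + n by omega, ← Nat.choose_symm_add]

theorem finrank_restrictTotalDegree (n N : ℕ) :
    Module.finrank k (restrictTotalDegree (Fin n) k N) = (N + n).choose n := by
  rw [← card_degree_le]
  have h := Module.finrank_eq_nat_card_basis (basisRestrictSupport k
    {s : Fin n →₀ ℕ | (s.sum fun _ e => e) ≤ N})
  exact h

/-- The algebra automorphism substituting `X + P` for `X`. -/
noncomputable def translateHom (P : Fin n → k) : MvPolynomial (Fin n) k →ₐ[k] MvPolynomial (Fin n) k :=
  aeval fun i => X i + C (P i)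

theorem translate_translate_neg (P : Fin n → k) (p : MvPolynomial (Fin n) k) :
    translateHom P (translateHom (-P) p) = p := by
  have : (translateHom P).comp (translateHom (-P)) = AlgHom.id k _ := by
    ext i : 1
    simp [translateHom]
  exact DFunLike.congr_fun this p

/-- The maximal ideal of a point. -/
noncomputable def pointIdeal (P : Fin n → k) : Ideal (MvPolynomial (Fin n) k) :=
  (idealOfVars (Fin n) k).comap (translateHom P)

theorem mem_idealOfVars_iff_eval (p : MvPolynomial (Fin n) k) :
    p ∈ idealOfVars (Fin n) k ↔ eval 0 p = 0 := by
  have := mem_pow_idealOfVars_iff' (R := k) (σ := Fin n) 1 p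
  rw [pow_one] at this
  have h0 : eval 0 p = coeff 0 p := eval₂Hom_zero_apply (RingHom.id k) p
  rw [this, h0]
  simp [Finsupp.degree_eq_zero_iff]

theorem mem_pointIdeal (P : Fin n → k) (p : MvPolynomial (Fin n) k) :
    p ∈ pointIdeal P ↔ eval P p = 0 := by
  rw [pointIdeal, Ideal.mem_comap, mem_idealOfVars_iff_eval]
  have : (aeval (0 : Fin n → k)).comp (translateHom P) = aeval P := by
    ext i; simp [translateHom]
  have h2 := DFunLike.congr_fun this p
  simp only [AlgHom.comp_apply, aeval_eq_eval] at h2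
  rw [← h2]

theorem isCoprime_pointIdeal {P Q : Fin n → k} (h : P ≠ Q) :
    IsCoprime (pointIdeal P) (pointIdeal Q) := by
  obtain ⟨i, hi⟩ := Function.ne_iff.1 h
  rw [Ideal.isCoprime_iff_exists]
  refine ⟨C (Q i - P i)⁻¹ * (X i - C (P i)), ?_, C (Q i - P i)⁻¹ * (C (Q i) - X i), ?_, ?_⟩
  · simp [mem_pointIdeal]
  · simp [mem_pointIdeal]
  · rw [← mul_add, show (X i - C (P i) + (C (Q i) - X i) : MvPolynomial (Fin n) k) =
      C (Q i - P i) by rw [map_sub]; ring, ← map_mul, inv_mul_cancel₀ (sub_ne_zero.2 hi.symm),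
      map_one]

theorem card_mul_choose_le [IsAlgClosed k] {ι : Type*} (F : ι → MvPolynomial (Fin n) k) {q c : ℕ}
    (Z : Finset (Fin n → k)) (hZ : ∀ P ∈ Z, ∀ i, eval P (F i) = 0) (m : ℕ)
    (hrep : ∀ p, ∃ r ∈ restrictTotalDegree (Fin n) k (q * m + c),
      p - r ∈ Ideal.span (Set.range F) ^ (m + 1)) :
    Z.card * (m + n).choose n ≤ (q * m + c + n).choose n := by
  classical
  have hfinite := (finite_degree_le n m).to_subtype
  have := Fintype.ofFinite {s : Fin n →₀ ℕ | s.degree ≤ m}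
  let Φ : MvPolynomial (Fin n) k →ₗ[k] (Z × {s : Fin n →₀ ℕ | s.degree ≤ m} → k) :=
    LinearMap.pi fun x => (lcoeff k x.2.1).comp (translateHom x.1.1).toLinearMap
  have hΦ : ∀ p P s, Φ p (P, s) = coeff s.1 (translateHom P.1 p) := fun p P s => rfl
  have hsub : ∀ P ∈ Z, Ideal.span (Set.range F) ≤ pointIdeal P := by
    intro P hP
    rw [Ideal.span_le]
    rintro _ ⟨i, rfl⟩
    exact (mem_pointIdeal _ _).2 (hZ P hP i)
  have hker : ∀ P : Fin n → k, ∀ p ∈ pointIdeal P ^ (m + 1), ∀ s : Fin n →₀ ℕ, s.degree ≤ m →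
      coeff s (translateHom P p) = 0 := by
    intro P p hp s hs
    have h1 : translateHom P p ∈ idealOfVars (Fin n) k ^ (m + 1) := by
      have h2 := Ideal.mem_map_of_mem (translateHom P) hp
      rw [Ideal.map_pow] at h2
      exact Ideal.pow_right_mono Ideal.map_comap_le _ h2
    exact (mem_pow_idealOfVars_iff' _ _).1 h1 s (Nat.lt_succ_of_le hs)
  have hsurj : Function.Surjective (Φ.comp (restrictTotalDegree (Fin n) k (q * m + c)).subtype) := by
    intro g
    obtain ⟨p, hp⟩ := Ideal.exists_forall_sub_mem_ideal
      (I := fun P : Z => pointIdeal P.1 ^ (m + 1))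
      (fun P Q hPQ => (isCoprime_pointIdeal fun h => hPQ (Subtype.ext h)).pow)
      (fun P : Z => translateHom (-P.1)
        (∑ s : {s : Fin n →₀ ℕ | s.degree ≤ m}, monomial s.1 (g (P, s))))
    obtain ⟨r, hr, hpr⟩ := hrep p
    refine ⟨⟨r, hr⟩, funext fun ⟨P, s⟩ => ?_⟩
    have e1 := hker P.1 _ (hp P) s.1 s.2
    have e2 := hker P.1 _ (Ideal.pow_right_mono (hsub P.1 P.2) _ hpr) s.1 s.2
    rw [map_sub, coeff_sub, sub_eq_zero] at e1 e2
    rw [translate_translate_neg, coeff_sum] at e1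
    change coeff s.1 (translateHom P.1 r) = _
    rw [← e2, e1, Finset.sum_eq_single s]
    · simp
    · intro t _ hts
      rw [coeff_monomial, if_neg fun h => hts (Subtype.ext h)]
    · simp
  have h1 := LinearMap.finrank_le_finrank_of_surjective hsurj
  rw [finrank_restrictTotalDegree, Module.finrank_fintype_fun_eq_card, Fintype.card_prod,
    Fintype.card_coe] at h1
  rwa [← card_degree_le, ← Nat.card_coe_set_eq, Nat.card_eq_fintype_card]

theorem le_pow_of_forall_choose_le {r q c n : ℕ}
    (h : ∀ m, r * (m + n).choose n ≤ (q * m + c + n).choose n) : r ≤ q ^ n := by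
  have h1 : ∀ m : ℕ, r * (m + 1) ^ n ≤ (q * (m + 1) + (c + n)) ^ n := by
    intro m
    calc r * (m + 1) ^ n ≤ r * (m + 1).ascFactorial n := by
          gcongr; exact Nat.pow_succ_le_ascFactorial _ _
      _ = n.factorial * (r * (m + n).choose n) := by
          rw [Nat.ascFactorial_eq_factorial_mul_choose]; ring
      _ ≤ n.factorial * (q * m + c + n).choose n := by gcongr; exact h m
      _ = (q * m + c + 1).ascFactorial n := by
          rw [Nat.ascFactorial_eq_factorial_mul_choose]
      _ ≤ (q * m + c + n) ^ n := Nat.ascFactorial_le_pow_add _ _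
      _ ≤ _ := by gcongr ?_ ^ n; nlinarith
  have h2 : Filter.Tendsto (fun m : ℕ => ((q : ℝ) + (c + n : ℕ) * (1 / ((m : ℝ) + 1))) ^ n)
      Filter.atTop (nhds (((q : ℝ) + (c + n : ℕ) * 0) ^ n)) :=
    ((tendsto_one_div_add_atTop_nhds_zero_nat.const_mul _).const_add _).pow n
  have h3 : (r : ℝ) ≤ ((q : ℝ) + (c + n : ℕ) * 0) ^ n := by
    refine ge_of_tendsto' h2 fun m => ?_
    have hm : (0 : ℝ) < (m : ℝ) + 1 := by positivity
    have h4 : (r : ℝ) * (m + 1) ^ n ≤ (q * (m + 1) + (c + n : ℕ)) ^ n := by exact_mod_cast h1 m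
    rw [← le_div_iff₀ (by positivity), ← div_pow] at h4
    refine h4.trans_eq ?_
    congr 1
    field_simp
  simp only [mul_zero, add_zero] at h3
  exact_mod_cast h3

/-- A finite common zero set in affine `n`-space of polynomials of degree at most `q` has at most
`q ^ n` points. -/
theorem card_common_zeros_le [IsAlgClosed k] {ι : Type*} (F : ι → MvPolynomial (Fin n) k) {q : ℕ}
    (hF : ∀ i, (F i).totalDegree ≤ q) (Z : Finset (Fin n → k))
    (hZ : ∀ P, P ∈ Z ↔ ∀ i, eval P (F i) = 0) : Z.card ≤ q ^ n := by
  obtain ⟨c, hc⟩ := exists_bounded_representatives (Ideal.span (Set.range F)) Z (by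
    intro P hP
    exact (hZ P).2 fun i => hP _ (Ideal.subset_span ⟨i, rfl⟩))
  exact le_pow_of_forall_choose_le fun m => card_mul_choose_le F Z (fun P hP => (hZ P).1 hP) m
    (exists_bounded_representatives_pow F (fun i => (mem_restrictTotalDegree _ _ _).2 (hF i)) hc m)

end Bezout

section Pencil

variable {k σ : Type*} [Field k]

/-- The restriction of a polynomial to the parametrized affine line `t ↦ a + t • b`. -/
noncomputable def pencil (a b : σ → k) (g : MvPolynomial σ k) : Polynomial k :=
  aeval (fun i => Polynomial.C (b i) * Polynomial.X + Polynomial.C (a i)) g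

theorem eval_pencil (a b : σ → k) (g : MvPolynomial σ k) (t : k) :
    (pencil a b g).eval t = eval (a + t • b) g := by
  have h : (Polynomial.aeval t).comp
      (aeval fun i => Polynomial.C (b i) * Polynomial.X + Polynomial.C (a i)) =
      aeval (R := k) (a + t • b) := by
    ext i
    simp [mul_comm t, add_comm (a i)]
  simpa [pencil, aeval_eq_eval, Polynomial.coe_aeval_eq_eval] using DFunLike.congr_fun h g

theorem natDegree_pencil_le (a b : σ → k) {g : MvPolynomial σ k} {m : ℕ}
    (hg : g.totalDegree ≤ m) : (pencil a b g).natDegree ≤ m := by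
  simpa [pencil] using aeval_natDegree_le g hg
    (fun i => Polynomial.C (b i) * Polynomial.X + Polynomial.C (a i))
    fun i => Polynomial.natDegree_linear_le

theorem eval_derivative_pencil [Fintype σ] (a b : σ → k) (g : MvPolynomial σ k) :
    (pencil a b g).derivative.eval 0 = ∑ i, eval a (pderiv i g) * b i := by
  classical
  have h0 : ∀ p, (pencil a b p).eval 0 = eval a p := fun p => by simp [eval_pencil]
  unfold pencil at *
  induction g using MvPolynomial.induction_on with
  | C c => simp [Polynomial.algebraMap_eq]
  | add p q hp hq => simp [hp, hq, add_mul, Finset.sum_add_distrib]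
  | mul_X p j hp =>
    simp only [map_mul, aeval_X, Polynomial.derivative_mul, Polynomial.eval_add,
      Polynomial.eval_mul, hp, h0, pderiv_mul, pderiv_X, map_add, eval_X, add_mul,
      Finset.sum_add_distrib]
    congr 1
    · simp [Finset.sum_mul, mul_right_comm]
    · simp [Pi.single_apply]

theorem MvPolynomial.IsHomogeneous.eval_smul {g : MvPolynomial σ k} {m : ℕ}
    (hg : g.IsHomogeneous m) (c : k) (v : σ → k) : eval (c • v) g = c ^ m * eval v g := by
  simp only [eval_eq, Finset.mul_sum]
  refine Finset.sum_congr rfl fun s hs => ?_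
  have h1 : s.degree = m := by
    rw [← hg (mem_support_iff.1 hs), Finsupp.degree_eq_weight_one]
    rfl
  simp only [Pi.smul_apply, smul_eq_mul, mul_pow, Finset.prod_mul_distrib]
  rw [Finset.prod_pow_eq_pow_sum, ← Finsupp.degree_apply, h1]
  ring

theorem Polynomial.eq_zero_of_forall_ne_zero [Infinite k] {p : Polynomial k}
    (h : ∀ t, t ≠ 0 → p.eval t = 0) : p = 0 := by
  refine Polynomial.eq_zero_of_infinite_isRoot p ?_
  exact (Set.finite_singleton (0 : k)).infinite_compl.mono fun t ht => h t ht

/-- If a homogeneous polynomial does not vanish on `a + t • b` for any `t`, it is constant there,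
and so determined on the span of `a` and `b`. -/
theorem eval_add_eq_of_forall_ne_zero [IsAlgClosed k] {g : MvPolynomial σ k} {m : ℕ}
    (hg : g.IsHomogeneous m) {a b : σ → k} (h : ∀ t : k, eval (a + t • b) g ≠ 0) (s : k) :
    eval (s • a + b) g = s ^ m * eval a g := by
  have : Infinite k := IsAlgClosed.instInfinite
  have hdeg : (pencil a b g).degree = 0 := by
    by_contra hne
    obtain ⟨t, ht⟩ := IsAlgClosed.exists_root _ hne
    exact h t (by rwa [← eval_pencil])
  have hconst : ∀ t : k, eval (a + t • b) g = eval a g := fun t => by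
    have h1 := eval_pencil a b g t
    have h2 := eval_pencil a b g 0
    rw [Polynomial.eq_C_of_degree_eq_zero hdeg, Polynomial.eval_C] at h1 h2
    rw [← h1, h2]
    simp
  have hp : pencil b a g - Polynomial.C (eval a g) * Polynomial.X ^ m = 0 := by
    refine Polynomial.eq_zero_of_forall_ne_zero fun t ht => ?_
    have : b + t • a = t • (a + t⁻¹ • b) := by
      rw [smul_add, smul_smul, mul_inv_cancel₀ ht, one_smul, add_comm]
    rw [Polynomial.eval_sub, eval_pencil, this, hg.eval_smul, hconst]
    simp [mul_comm (eval a g)]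
  have := congrArg (Polynomial.eval s) hp
  rw [Polynomial.eval_sub, eval_pencil, add_comm b] at this
  simpa [sub_eq_zero, mul_comm (eval a g)] using this

theorem exists_eval_eq_zero [IsAlgClosed k] {g : MvPolynomial σ k} {m : ℕ}
    (hg : g.IsHomogeneous m) (hm : m ≠ 0) {a b : σ → k} (hab : LinearIndependent k ![a, b]) :
    ∃ s t : k, s • a + t • b ≠ 0 ∧ eval (s • a + t • b) g = 0 := by
  rw [LinearIndependent.pair_iff] at hab
  by_cases h : ∃ t : k, eval (a + t • b) g = 0
  · obtain ⟨t, ht⟩ := h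
    exact ⟨1, t, fun h0 => one_ne_zero (hab _ _ h0).1, by simpa using ht⟩
  · push Not at h
    refine ⟨0, 1, fun h0 => one_ne_zero (hab _ _ h0).2, ?_⟩
    simpa [hm] using eval_add_eq_of_forall_ne_zero hg h 0

/-- A syzygy `s A + t B = 0` on a pencil forces a common zero of `A` and `B`. -/
theorem exists_common_zero [IsAlgClosed k] {A B : MvPolynomial σ k} {m : ℕ}
    (hB : B.IsHomogeneous m) (hm : 2 ≤ m) {a b : σ → k} (hab : LinearIndependent k ![a, b])
    (h : ∀ s t : k, s * eval (s • a + t • b) A + t * eval (s • a + t • b) B = 0) :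
    ∃ s t : k, s • a + t • b ≠ 0 ∧ eval (s • a + t • b) A = 0 ∧ eval (s • a + t • b) B = 0 := by
  have : Infinite k := IsAlgClosed.instInfinite
  rw [LinearIndependent.pair_iff] at hab
  by_cases hr : ∃ t : k, eval (a + t • b) B = 0
  · obtain ⟨t, ht⟩ := hr
    refine ⟨1, t, fun h0 => one_ne_zero (hab _ _ h0).1, ?_, by simpa using ht⟩
    simpa [ht] using h 1 t
  · push Not at hr
    have hB' := eval_add_eq_of_forall_ne_zero hB hr
    refine ⟨0, 1, fun h0 => one_ne_zero (hab _ _ h0).2, ?_, ?_⟩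
    · have hp : pencil b a A + Polynomial.C (eval a B) * Polynomial.X ^ (m - 1) = 0 := by
        refine Polynomial.eq_zero_of_forall_ne_zero fun t ht => ?_
        have h1 := h t 1
        rw [one_smul, hB', ← Nat.sub_add_cancel (by omega : 1 ≤ m), pow_succ] at h1
        rw [Polynomial.eval_add, eval_pencil, add_comm b]
        refine mul_left_cancel₀ ht ?_
        simp only [Polynomial.eval_mul, Polynomial.eval_C, Polynomial.eval_pow, Polynomial.eval_X]
        linear_combination h1
      have := congrArg (Polynomial.eval 0) hp
      rw [Polynomial.eval_add, eval_pencil] at this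
      simpa [show m - 1 ≠ 0 by omega] using this
    · simpa [show m ≠ 0 by omega] using hB' 0

theorem pencil_ne_zero [Infinite k] {g : MvPolynomial σ k} {m : ℕ} (hg : g.IsHomogeneous m)
    (a : σ → k) {b : σ → k} (hb : eval b g ≠ 0) : pencil a b g ≠ 0 := by
  intro h
  have hp : pencil b a g = 0 := by
    refine Polynomial.eq_zero_of_forall_ne_zero fun t ht => ?_
    have h1 : b + t • a = t • (a + t⁻¹ • b) := by
      rw [smul_add, smul_smul, mul_inv_cancel₀ ht, one_smul, add_comm]
    rw [eval_pencil, h1, hg.eval_smul, ← eval_pencil, h, Polynomial.eval_zero, mul_zero]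
  have := eval_pencil b a g 0
  rw [hp] at this
  exact hb (by simpa using this.symm)

end Pencil

section TwoDimensional

variable {k V : Type*} [Field k] [AddCommGroup V] [Module k V]

theorem finrank_span_pair {a b : V} (h : LinearIndependent k ![a, b]) :
    Module.finrank k (Submodule.span k {a, b}) = 2 := by
  have := finrank_span_eq_card h
  rwa [Matrix.range_cons_cons_empty, Fintype.card_fin] at this

theorem eq_span_pair_of_finrank_eq_two {W : Submodule k V} (hW : Module.finrank k W = 2) {a b : V}
    (ha : a ∈ W) (hb : b ∈ W) (h : LinearIndependent k ![a, b]) :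
    W = Submodule.span k {a, b} := by
  have : FiniteDimensional k W := Module.finite_of_finrank_pos (by omega)
  refine (Submodule.eq_of_le_of_finrank_eq ?_ ?_).symm
  · rw [Submodule.span_le]
    rintro x (rfl | rfl) <;> assumption
  · rw [finrank_span_pair h, hW]

theorem exists_eq_span_pair {W : Submodule k V} (hW : Module.finrank k W = 2) :
    ∃ a b, LinearIndependent k ![a, b] ∧ W = Submodule.span k {a, b} := by
  have : FiniteDimensional k W := Module.finite_of_finrank_pos (by omega)
  let B := Module.finBasisOfFinrankEq k W hW
  have h : LinearIndependent k ![(B 0 : V), B 1] := by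
    have h1 := B.linearIndependent.map' W.subtype W.ker_subtype
    have h2 : W.subtype ∘ B = ![(B 0 : V), B 1] := by
      funext i
      fin_cases i <;> rfl
    rwa [h2] at h1
  exact ⟨B 0, B 1, h, eq_span_pair_of_finrank_eq_two hW (B 0).2 (B 1).2 h⟩

theorem finrank_inf_le_one {W W' : Submodule k V} (hW : Module.finrank k W = 2)
    (hW' : Module.finrank k W' = 2) (h : W ≠ W') : Module.finrank k ↥(W ⊓ W') ≤ 1 := by
  have : FiniteDimensional k W := Module.finite_of_finrank_pos (by omega)
  have : FiniteDimensional k W' := Module.finite_of_finrank_pos (by omega)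
  by_contra! hlt
  have h1 : W ⊓ W' = W := Submodule.eq_of_le_of_finrank_le inf_le_left (by omega)
  have h2 : W ⊓ W' = W' := Submodule.eq_of_le_of_finrank_le inf_le_right (by omega)
  exact h (h1.symm.trans h2)

theorem linearIndependent_pair_of_disjoint {W W' : Submodule k V} (h : W ⊓ W' = ⊥) {a b : V}
    (ha : a ∈ W) (hb : b ∈ W') (ha0 : a ≠ 0) (hb0 : b ≠ 0) : LinearIndependent k ![a, b] := by
  rw [LinearIndependent.pair_iff]
  intro s t hst
  have h1 : s • a ∈ W ⊓ W' := by
    refine ⟨W.smul_mem s ha, ?_⟩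
    rw [eq_neg_of_add_eq_zero_left hst]
    exact W'.neg_mem (W'.smul_mem t hb)
  rw [h, Submodule.mem_bot] at h1
  rw [h1, zero_add] at hst
  exact ⟨(smul_eq_zero.1 h1).resolve_right ha0, (smul_eq_zero.1 hst).resolve_right hb0⟩

theorem exists_ne_zero_mem_inf {W W' : Submodule k V} (h : W ⊓ W' ≠ ⊥) :
    ∃ x, x ∈ W ∧ x ∈ W' ∧ x ≠ 0 := by
  obtain ⟨x, hx, hx0⟩ := Submodule.exists_mem_ne_zero_of_ne_bot h
  exact ⟨x, hx.1, hx.2, hx0⟩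

theorem sup_eq_top_of_skew [FiniteDimensional k V] (hV : Module.finrank k V = 4)
    {L M : Submodule k V} (hL : Module.finrank k L = 2) (hM : Module.finrank k M = 2)
    (h : L ⊓ M = ⊥) : L ⊔ M = ⊤ := by
  refine Submodule.eq_top_of_finrank_eq ?_
  have := Submodule.finrank_sup_add_finrank_inf_eq L M
  rw [h, finrank_bot] at this
  omega

end TwoDimensional

section Gradient

variable {k : Type*} [Field k]

/-- The differential of `f` at `u`. -/
noncomputable def grad (f : MvPolynomial (Fin 4) k) (u : Fin 4 → k) : (Fin 4 → k) →ₗ[k] k :=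
  ∑ i, eval u (pderiv i f) • LinearMap.proj i

theorem grad_apply (f : MvPolynomial (Fin 4) k) (u v : Fin 4 → k) :
    grad f u v = ∑ i, eval u (pderiv i f) * v i := by
  simp [grad]

/-- The directional derivative of `f` along `v`. -/
noncomputable def dirDeriv (f : MvPolynomial (Fin 4) k) (v : Fin 4 → k) :
    MvPolynomial (Fin 4) k := ∑ i, C (v i) * pderiv i f

theorem eval_dirDeriv (f : MvPolynomial (Fin 4) k) (u v : Fin 4 → k) :
    eval u (dirDeriv f v) = grad f u v := by
  simp [dirDeriv, grad_apply, mul_comm]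

theorem isHomogeneous_dirDeriv {f : MvPolynomial (Fin 4) k} {d : ℕ} (hf : f.IsHomogeneous d)
    (v : Fin 4 → k) : (dirDeriv f v).IsHomogeneous (d - 1) :=
  IsHomogeneous.sum _ _ _ fun _ _ => (hf.pderiv).C_mul _

theorem grad_eq_zero_of_forall_mem [Infinite k] {f : MvPolynomial (Fin 4) k}
    {W : Submodule k (Fin 4 → k)} (hW : ∀ v ∈ W, eval v f = 0) {u v : Fin 4 → k} (hu : u ∈ W)
    (hv : v ∈ W) : grad f u v = 0 := by
  have hp : pencil u v f = 0 := Polynomial.funext fun t => by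
    rw [eval_pencil, hW _ (W.add_mem hu (W.smul_mem t hv)), Polynomial.eval_zero]
  rw [grad_apply, ← eval_derivative_pencil, hp]
  simp

theorem IsSmoothSurface.grad_ne_zero {f : MvPolynomial (Fin 4) k} {d : ℕ}
    (hf : IsSmoothSurface f d) {u : Fin 4 → k} (hu : u ≠ 0) (h : eval u f = 0) : grad f u ≠ 0 := by
  intro h0
  refine hf.2.2 u hu ⟨h, fun i => ?_⟩
  have := LinearMap.congr_fun h0 (Pi.single i 1)
  simpa [grad_apply, Pi.single_apply] using this

theorem IsSmoothSurface.ker_ne_top {f : MvPolynomial (Fin 4) k} {d : ℕ}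
    (hf : IsSmoothSurface f d) {u : Fin 4 → k} (hu : u ≠ 0) (h : eval u f = 0) :
    LinearMap.ker (grad f u) ≠ ⊤ := fun h0 => hf.grad_ne_zero hu h (LinearMap.ker_eq_top.1 h0)

theorem IsLineOn.le_ker_grad [Infinite k] {f : MvPolynomial (Fin 4) k}
    {W : Submodule k (Fin 4 → k)} (hW : IsLineOn f W) {u : Fin 4 → k} (hu : u ∈ W) :
    W ≤ LinearMap.ker (grad f u) := fun _ hv => grad_eq_zero_of_forall_mem hW.2 hu hv

/-- A line meeting two intersecting lines of a smooth surface lies in their plane. -/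
theorem IsSmoothSurface.le_sup_of_meet [Infinite k] {f : MvPolynomial (Fin 4) k} {d : ℕ}
    (hf : IsSmoothSurface f d) {L T M : Submodule k (Fin 4 → k)} (hL : IsLineOn f L)
    (hT : IsLineOn f T) (hM : IsLineOn f M) (hLT : L ≠ T) (hML : M ⊓ L ≠ ⊥) (hMT : M ⊓ T ≠ ⊥) :
    M ≤ L ⊔ T := by
  obtain ⟨x, hxM, hxL, hx0⟩ := exists_ne_zero_mem_inf hML
  obtain ⟨y, hyM, hyT, hy0⟩ := exists_ne_zero_mem_inf hMT
  by_cases hxy : LinearIndependent k ![x, y]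
  · rw [eq_span_pair_of_finrank_eq_two hM.1 hxM hyM hxy, Submodule.span_le]
    rintro z (rfl | rfl)
    · exact Submodule.mem_sup_left hxL
    · exact Submodule.mem_sup_right hyT
  · have hxT : x ∈ T := by
      rw [LinearIndependent.pair_symm_iff, LinearIndependent.pair_iff' hy0] at hxy
      push Not at hxy
      obtain ⟨c, rfl⟩ := hxy
      exact T.smul_mem c hyT
    have hle : L ⊔ T ≤ LinearMap.ker (grad f x) :=
      sup_le (hL.le_ker_grad hxL) (hT.le_ker_grad hxT)
    have hker := hf.ker_ne_top hx0 (hL.2 x hxL)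
    have h1 : 3 ≤ Module.finrank k ↥(L ⊔ T) := by
      have := Submodule.finrank_sup_add_finrank_inf_eq L T
      have := finrank_inf_le_one hL.1 hT.1 hLT
      have := hL.1
      have := hT.1
      omega
    have h2 : Module.finrank k ↥(LinearMap.ker (grad f x)) < 4 := by
      have := Submodule.finrank_lt hker
      simpa using this
    have h3 : L ⊔ T = LinearMap.ker (grad f x) :=
      Submodule.eq_of_le_of_finrank_le hle (by omega)
    rw [h3]
    exact hM.le_ker_grad hxM

end Gradient

section Plane

variable {k : Type*} [Field k] [IsAlgClosed k]

/-- A smooth surface of degree at least two contains no plane. -/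
theorem IsSmoothSurface.exists_eval_ne_zero {f : MvPolynomial (Fin 4) k} {d : ℕ}
    (hf : IsSmoothSurface f d) (hd : 2 ≤ d) {H : Submodule k (Fin 4 → k)}
    (hH : Module.finrank k H = 3) : ∃ P ∈ H, eval P f ≠ 0 := by
  have : Infinite k := IsAlgClosed.instInfinite
  by_contra! hzero
  have hne : H ≠ ⊤ := by
    rintro rfl
    simp at hH
  obtain ⟨e, -, he⟩ := SetLike.exists_of_lt hne.lt_top
  let B := Module.finBasisOfFinrankEq k H hH
  have hab : LinearIndependent k ![(B 0 : Fin 4 → k), B 1] := by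
    have h := (Fintype.linearIndependent_iff.1 B.linearIndependent)
    rw [LinearIndependent.pair_iff]
    intro s t hst
    have h1 := h ![s, t, 0] (by
      refine Subtype.ext ?_
      simpa [Fin.sum_univ_three] using hst)
    exact ⟨h1 0, h1 1⟩
  obtain ⟨s, t, hu0, hu⟩ := exists_eval_eq_zero (isHomogeneous_dirDeriv hf.2.1 e)
    (by omega) hab
  have huH : s • (B 0 : Fin 4 → k) + t • (B 1 : Fin 4 → k) ∈ H :=
    H.add_mem (H.smul_mem s (B 0).2) (H.smul_mem t (B 1).2)
  refine hf.ker_ne_top hu0 (hzero _ huH) ?_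
  have hle : H ≤ LinearMap.ker (grad f (s • (B 0 : Fin 4 → k) + t • (B 1 : Fin 4 → k))) :=
    fun h hh =>
      grad_eq_zero_of_forall_mem hzero huH hh
  rw [eval_dirDeriv] at hu
  have hlt := Submodule.finrank_lt_finrank_of_lt (SetLike.lt_iff_le_and_exists.2 ⟨hle, e, hu, he⟩)
  refine Submodule.eq_top_of_finrank_eq (le_antisymm (Submodule.finrank_le _) ?_)
  simp only [Module.finrank_fintype_fun_eq_card, Fintype.card_fin]
  omega

theorem exists_mem_forall_notMem {V : Type*} [AddCommGroup V] [Module k V] (H : Submodule k V)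
    (s : Finset (Submodule k V)) (hs : ∀ p ∈ s, ¬ H ≤ p) : ∃ x ∈ H, ∀ p ∈ s, x ∉ p := by
  have : Infinite k := IsAlgClosed.instInfinite
  classical
  have h := Subspace.biUnion_ne_univ_of_top_notMem (k := k) (E := H)
    (s := s.image fun p => p.comap H.subtype) (by
      simp only [Finset.mem_image, not_exists, not_and]
      intro p hp h
      exact hs p hp (Submodule.comap_subtype_eq_top.1 h))
  obtain ⟨x, hx⟩ := (Set.ne_univ_iff_exists_notMem _).1 h
  refine ⟨x, x.2, fun p hp hxp => hx ?_⟩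
  simp only [Set.mem_iUnion]
  exact ⟨p.comap H.subtype, Finset.mem_image_of_mem _ hp, hxp⟩

theorem IsSmoothSurface.card_lines_in_plane_le {f : MvPolynomial (Fin 4) k} {d : ℕ}
    (hf : IsSmoothSurface f d) (hd : 2 ≤ d) {H : Submodule k (Fin 4 → k)}
    (hH : Module.finrank k H = 3) (Z : Finset (Submodule k (Fin 4 → k)))
    (hZ : ∀ W ∈ Z, IsLineOn f W ∧ W ≤ H) : Z.card ≤ d := by
  classical
  obtain ⟨P, hPH, hP⟩ := hf.exists_eval_ne_zero hd hH
  obtain ⟨R, hRH, hR⟩ := exists_mem_forall_notMem H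
    (Z.offDiag.image fun p => (p.1 ⊓ p.2) ⊔ Submodule.span k {P}) (by
      intro p hp hle
      obtain ⟨⟨W, W'⟩, hWW, rfl⟩ := Finset.mem_image.1 hp
      rw [Finset.mem_offDiag] at hWW
      have h1 := finrank_inf_le_one (hZ W hWW.1).1.1 (hZ W' hWW.2.1).1.1 hWW.2.2
      have h2 := Submodule.finrank_mono hle
      have h3 := Submodule.finrank_add_le_finrank_add_finrank (W ⊓ W') (Submodule.span k {P})
      have h4 := finrank_span_le_card (R := k) ({P} : Set (Fin 4 → k))
      simp only [Set.toFinset_singleton, Finset.card_singleton] at h2 h4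
      omega)
  have hex : ∀ W ∈ Z, ∃ t : k, R + t • P ∈ W := by
    intro W hW
    obtain ⟨hWf, hWH⟩ := hZ W hW
    have hPW : P ∉ W := fun h => hP (hWf.2 P h)
    have h1 : W < W ⊔ Submodule.span k {P} := by
      refine lt_of_le_of_ne le_sup_left fun h => hPW ?_
      rw [h]
      exact Submodule.mem_sup_right (Submodule.mem_span_singleton_self P)
    have h2 := Submodule.finrank_lt_finrank_of_lt h1
    have h3 : W ⊔ Submodule.span k {P} = H := by
      refine Submodule.eq_of_le_of_finrank_le (sup_le hWH ?_) (by have := hWf.1; omega)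
      rwa [Submodule.span_singleton_le_iff_mem]
    rw [← h3] at hRH
    obtain ⟨w, hw, y, hy, rfl⟩ := Submodule.mem_sup.1 hRH
    obtain ⟨c, rfl⟩ := Submodule.mem_span_singleton.1 hy
    exact ⟨-c, by simpa using hw⟩
  choose! t ht using hex
  have : Infinite k := IsAlgClosed.instInfinite
  have hp : pencil R P f ≠ 0 := pencil_ne_zero hf.2.1 R hP
  calc Z.card ≤ (pencil R P f).roots.toFinset.card := by
        refine Finset.card_le_card_of_injOn t ?_ ?_
        · intro W hW
          simp only [Finset.mem_coe, Multiset.mem_toFinset]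
          rw [Polynomial.mem_roots hp, Polynomial.IsRoot, eval_pencil]
          exact (hZ W hW).1.2 _ (ht W hW)
        · intro W hW W' hW' htt
          by_contra hne
          have hWW : (W, W') ∈ Z.offDiag := Finset.mem_offDiag.2 ⟨hW, hW', hne⟩
          refine hR _ (Finset.mem_image_of_mem _ hWW) ?_
          refine Submodule.mem_sup.2 ⟨R + t W • P, ⟨ht W hW, ?_⟩, -(t W • P),
            Submodule.neg_mem _ (Submodule.smul_mem _ _ (Submodule.mem_span_singleton_self P)),
            by simp⟩
          rw [htt]
          exact ht W' hW'
    _ ≤ Multiset.card (pencil R P f).roots := Multiset.toFinset_card_le _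
    _ ≤ (pencil R P f).natDegree := Polynomial.card_roots' _
    _ ≤ d := natDegree_pencil_le _ _ hf.2.1.totalDegree_le

end Plane

section Transversals

variable {k : Type*} [Field k]

/-- The components of the polynomial map sending `u` to the vector of `span {c, e}` killed by the
differential of `f` at `u`. -/
noncomputable def tangentPoly (f : MvPolynomial (Fin 4) k) (c e : Fin 4 → k) (i : Fin 4) :
    MvPolynomial (Fin 4) k := C (c i) * dirDeriv f e - C (e i) * dirDeriv f c

/-- The vector of `span {c, e}` killed by the differential of `f` at `u`. -/
noncomputable def tangentVec (f : MvPolynomial (Fin 4) k) (c e u : Fin 4 → k) : Fin 4 → k :=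
  grad f u e • c - grad f u c • e

theorem eval_tangentPoly (f : MvPolynomial (Fin 4) k) (c e u : Fin 4 → k) :
    (fun i => eval u (tangentPoly f c e i)) = tangentVec f c e u := by
  funext i
  simp [tangentPoly, tangentVec, eval_dirDeriv, mul_comm]

theorem isHomogeneous_tangentPoly {f : MvPolynomial (Fin 4) k} {d : ℕ} (hf : f.IsHomogeneous d)
    (c e : Fin 4 → k) (i : Fin 4) : (tangentPoly f c e i).IsHomogeneous (d - 1) :=
  ((isHomogeneous_dirDeriv hf e).C_mul _).sub ((isHomogeneous_dirDeriv hf c).C_mul _)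

theorem eval_bind_tangentPoly (f g : MvPolynomial (Fin 4) k) (c e u : Fin 4 → k) :
    eval u (bind₁ (tangentPoly f c e) g) = eval (tangentVec f c e u) g := by
  rw [← eval_tangentPoly, ← aeval_eq_eval, ← aeval_eq_eval]
  exact aeval_bind₁ _ _ _

/-- The polynomial whose zeros on a line `L` are the points where a line joining `L` to
`span {c, e}` can lie on the surface. -/
noncomputable def transversalPoly (f : MvPolynomial (Fin 4) k) (c e : Fin 4 → k) :
    MvPolynomial (Fin 4) k := ∑ i, X i * bind₁ (tangentPoly f c e) (pderiv i f)

theorem isHomogeneous_bind_tangentPoly {f g : MvPolynomial (Fin 4) k} {d m : ℕ}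
    (hf : f.IsHomogeneous d) (hg : g.IsHomogeneous m) (c e : Fin 4 → k) :
    (bind₁ (tangentPoly f c e) g).IsHomogeneous ((d - 1) * m) :=
  hg.aeval _ fun i => isHomogeneous_tangentPoly hf c e i

theorem isHomogeneous_transversalPoly {f : MvPolynomial (Fin 4) k} {d : ℕ}
    (hf : f.IsHomogeneous d) (c e : Fin 4 → k) :
    (transversalPoly f c e).IsHomogeneous ((d - 1) ^ 2 + 1) := by
  refine IsHomogeneous.sum _ _ _ fun i _ => ?_
  rw [add_comm, sq]
  exact (isHomogeneous_X k i).mul (isHomogeneous_bind_tangentPoly hf hf.pderiv c e)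

theorem eval_transversalPoly (f : MvPolynomial (Fin 4) k) (c e u : Fin 4 → k) :
    eval u (transversalPoly f c e) = grad f (tangentVec f c e u) u := by
  simp [transversalPoly, eval_bind_tangentPoly, grad_apply, mul_comm]

theorem grad_tangentVec (f : MvPolynomial (Fin 4) k) (c e u : Fin 4 → k) :
    grad f u (tangentVec f c e u) = 0 := by
  simp [tangentVec, mul_comm]

theorem tangentVec_mem (f : MvPolynomial (Fin 4) k) (c e u : Fin 4 → k) :
    tangentVec f c e u ∈ Submodule.span k {c, e} :=
  Submodule.mem_span_pair.2 ⟨grad f u e, -grad f u c, by simp [tangentVec, sub_eq_add_neg]⟩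

variable [IsAlgClosed k] {f : MvPolynomial (Fin 4) k} {d : ℕ} {L : Submodule k (Fin 4 → k)}
  {c e : Fin 4 → k}

theorem IsSmoothSurface.not_le_ker_grad (hf : IsSmoothSurface f d) {L M : Submodule k (Fin 4 → k)}
    (hL : IsLineOn f L) (hM : IsLineOn f M) (h : L ⊓ M = ⊥) {u : Fin 4 → k} (hu : u ∈ L)
    (hu0 : u ≠ 0) : ¬ M ≤ LinearMap.ker (grad f u) := by
  have : Infinite k := IsAlgClosed.instInfinite
  intro hle
  refine hf.ker_ne_top hu0 (hL.2 u hu) (top_le_iff.1 ?_)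
  rw [← sup_eq_top_of_skew (by simp) hL.1 hM.1 h]
  exact sup_le (hL.le_ker_grad hu) hle

theorem IsSmoothSurface.tangentVec_ne_zero (hf : IsSmoothSurface f d) (hL : IsLineOn f L)
    (hce : LinearIndependent k ![c, e]) (hM : IsLineOn f (Submodule.span k {c, e}))
    (h : L ⊓ Submodule.span k {c, e} = ⊥) {u : Fin 4 → k} (hu : u ∈ L) (hu0 : u ≠ 0) :
    tangentVec f c e u ≠ 0 := by
  intro h0
  rw [tangentVec, sub_eq_add_neg, ← neg_smul] at h0
  have h1 := LinearIndependent.pair_iff.1 hce _ _ h0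
  refine hf.not_le_ker_grad hL hM h hu hu0 (Submodule.span_le.2 ?_)
  rintro x (rfl | rfl)
  · simpa using h1.2
  · simpa using h1.1

/-- A line of the surface meeting `span {c, e}` and passing through `u` passes through
`tangentVec f c e u`. -/
theorem IsSmoothSurface.tangentVec_mem_of_meet (hf : IsSmoothSurface f d) (hL : IsLineOn f L)
    (hM : IsLineOn f (Submodule.span k {c, e})) (h : L ⊓ Submodule.span k {c, e} = ⊥)
    {T : Submodule k (Fin 4 → k)} (hT : IsLineOn f T) (hTM : T ⊓ Submodule.span k {c, e} ≠ ⊥)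
    {u : Fin 4 → k} (hu : u ∈ L) (huT : u ∈ T) (hu0 : u ≠ 0) : tangentVec f c e u ∈ T := by
  have : Infinite k := IsAlgClosed.instInfinite
  obtain ⟨v, hvT, hvM, hv0⟩ := exists_ne_zero_mem_inf hTM
  by_cases hi : LinearIndependent k ![v, tangentVec f c e u]
  · refine absurd ?_ (hf.not_le_ker_grad hL hM h hu hu0)
    rw [eq_span_pair_of_finrank_eq_two hM.1 hvM (tangentVec_mem f c e u) hi, Submodule.span_le]
    rintro x (rfl | rfl)
    · exact hT.le_ker_grad huT hvT
    · exact grad_tangentVec f c e u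
  · rw [LinearIndependent.pair_iff' hv0] at hi
    push Not at hi
    obtain ⟨x, hx⟩ := hi
    rw [← hx]
    exact T.smul_mem x hvT

theorem IsSmoothSurface.exists_eval_transversalPoly_ne_zero (hf : IsSmoothSurface f d)
    (hd : 3 ≤ d) (hL : IsLineOn f L) (hce : LinearIndependent k ![c, e])
    (hM : IsLineOn f (Submodule.span k {c, e})) (h : L ⊓ Submodule.span k {c, e} = ⊥) :
    ∃ u ∈ L, eval u (transversalPoly f c e) ≠ 0 := by
  by_contra! hzero
  obtain ⟨a, b, hab, rfl⟩ := exists_eq_span_pair hL.1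
  have hm : 2 ≤ (d - 1) * (d - 1) := by
    have : 2 ≤ d - 1 := by omega
    nlinarith
  obtain ⟨s, t, hu0, hA, hB⟩ := exists_common_zero
    (A := bind₁ (tangentPoly f c e) (dirDeriv f a))
    (isHomogeneous_bind_tangentPoly hf.2.1 (isHomogeneous_dirDeriv hf.2.1 b) c e) hm hab (by
      intro s t
      have := hzero _ (Submodule.mem_span_pair.2 ⟨s, t, rfl⟩)
      rw [eval_transversalPoly, map_add, map_smul, map_smul] at this
      simpa only [eval_bind_tangentPoly, eval_dirDeriv, smul_eq_mul] using this)
  have hu : s • a + t • b ∈ Submodule.span k {a, b} := Submodule.mem_span_pair.2 ⟨s, t, rfl⟩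
  rw [eval_bind_tangentPoly, eval_dirDeriv] at hA hB
  refine hf.not_le_ker_grad hM hL ((inf_comm ..).trans h) (tangentVec_mem f c e _)
    (hf.tangentVec_ne_zero hL hce hM h hu hu0) (Submodule.span_le.2 ?_)
  rintro x (rfl | rfl)
  · exact hA
  · exact hB

/-- At most `(d - 1) ^ 2 + 1` lines of a smooth surface of degree `d` meet two given skew lines of
the surface. -/
theorem IsSmoothSurface.card_transversals_le (hf : IsSmoothSurface f d) (hd : 3 ≤ d)
    {L M : Submodule k (Fin 4 → k)} (hL : IsLineOn f L) (hM : IsLineOn f M) (h : L ⊓ M = ⊥)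
    (Z : Finset (Submodule k (Fin 4 → k)))
    (hZ : ∀ T ∈ Z, IsLineOn f T ∧ T ⊓ L ≠ ⊥ ∧ T ⊓ M ≠ ⊥) : Z.card ≤ (d - 1) ^ 2 + 1 := by
  classical
  have : Infinite k := IsAlgClosed.instInfinite
  obtain ⟨c, e, hce, rfl⟩ := exists_eq_span_pair hM.1
  have hF := isHomogeneous_transversalPoly hf.2.1 c e
  obtain ⟨b, hbL, hb⟩ := hf.exists_eval_transversalPoly_ne_zero hd hL hce hM h
  have hb0 : b ≠ 0 := by
    rintro rfl
    rw [eval_transversalPoly, map_zero] at hb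
    exact hb rfl
  obtain ⟨a, haL, ha⟩ : ∃ a ∈ L, a ∉ Submodule.span k {b} := by
    by_contra! hle
    have h1 := Submodule.finrank_mono (show L ≤ Submodule.span k {b} from hle)
    rw [finrank_span_singleton hb0, hL.1] at h1
    omega
  have hba : LinearIndependent k ![b, a] := by
    rw [LinearIndependent.pair_iff' hb0]
    intro x hx
    exact ha (Submodule.mem_span_singleton.2 ⟨x, hx⟩)
  have hne : ∀ t : k, a + t • b ≠ 0 := fun t h0 =>
    one_ne_zero (LinearIndependent.pair_iff.1 hba t 1 (by rw [one_smul, add_comm, h0])).2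
  have hmem : ∀ t : k, a + t • b ∈ L := fun t => L.add_mem haL (L.smul_mem t hbL)
  have hroot : ∀ T ∈ Z, ∀ u ∈ L, u ∈ T → eval u (transversalPoly f c e) = 0 := by
    intro T hT u hu huT
    rw [eval_transversalPoly]
    rcases eq_or_ne u 0 with rfl | hu0
    · exact map_zero _
    · exact grad_eq_zero_of_forall_mem (hZ T hT).1.2
        (hf.tangentVec_mem_of_meet hL hM h (hZ T hT).1 (hZ T hT).2.2 hu huT hu0) huT
  have hex : ∀ T ∈ Z, ∃ t : k, a + t • b ∈ T := by
    intro T hT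
    obtain ⟨u, huT, huL, hu0⟩ := exists_ne_zero_mem_inf (hZ T hT).2.1
    have hu := huL
    rw [eq_span_pair_of_finrank_eq_two hL.1 hbL haL hba] at hu
    obtain ⟨x, y, rfl⟩ := Submodule.mem_span_pair.1 hu
    have hy : y ≠ 0 := by
      rintro rfl
      rw [zero_smul, add_zero] at huL huT hu0
      have h1 := hroot T hT _ huL huT
      rw [hF.eval_smul] at h1
      have hx : x = 0 := eq_zero_of_pow_eq_zero ((mul_eq_zero.1 h1).resolve_right hb)
      exact hu0 (by rw [hx, zero_smul])
    refine ⟨y⁻¹ * x, ?_⟩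
    have h2 : a + (y⁻¹ * x) • b = y⁻¹ • (x • b + y • a) := by
      rw [smul_add, smul_smul, smul_smul, inv_mul_cancel₀ hy, one_smul, add_comm]
    rw [h2]
    exact T.smul_mem _ huT
  choose! t ht using hex
  have hp := pencil_ne_zero hF a hb
  calc Z.card ≤ (pencil a b (transversalPoly f c e)).roots.toFinset.card := by
        refine Finset.card_le_card_of_injOn t ?_ ?_
        · intro T hT
          simp only [Finset.mem_coe, Multiset.mem_toFinset]
          rw [Polynomial.mem_roots hp, Polynomial.IsRoot, eval_pencil]
          exact hroot T hT _ (hmem _) (ht T hT)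
        · intro T hT T' hT' htt
          have hi := linearIndependent_pair_of_disjoint h (hmem (t T)) (tangentVec_mem f c e _)
            (hne _) (hf.tangentVec_ne_zero hL hce hM h (hmem (t T)) (hne _))
          have hspan : ∀ T₀ ∈ Z, a + t T • b ∈ T₀ → T₀ =
              Submodule.span k {a + t T • b, tangentVec f c e (a + t T • b)} := fun T₀ h₀ hm =>
            eq_span_pair_of_finrank_eq_two (hZ T₀ h₀).1.1 hm
              (hf.tangentVec_mem_of_meet hL hM h (hZ T₀ h₀).1 (hZ T₀ h₀).2.2 (hmem _) hm
                (hne _)) hi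
          rw [hspan T hT (ht T hT), ← hspan T' hT' (htt ▸ ht T' hT')]
    _ ≤ Multiset.card (pencil a b (transversalPoly f c e)).roots := Multiset.toFinset_card_le _
    _ ≤ (pencil a b (transversalPoly f c e)).natDegree := Polynomial.card_roots' _
    _ ≤ (d - 1) ^ 2 + 1 := natDegree_pencil_le _ _ hF.totalDegree_le

end Transversals

section Skew

variable {k : Type*} [Field k] {n : ℕ}

/-- `A` and `B` have degree at most `m` and, in degree `m`, the same homogeneous component; the
latter is expressed with the help of an auxiliary variable `j`. -/
def CongrBelow (j : Fin n) (m : ℕ) (A B : MvPolynomial (Fin n) k) : Prop :=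
  A ∈ restrictTotalDegree (Fin n) k m ∧ B ∈ restrictTotalDegree (Fin n) k m ∧
    (A - B) * X j ∈ restrictTotalDegree (Fin n) k m

theorem CongrBelow.mul {j : Fin n} {a b : ℕ} {A B A' B' : MvPolynomial (Fin n) k}
    (h : CongrBelow j a A B) (h' : CongrBelow j b A' B') :
    CongrBelow j (a + b) (A * A') (B * B') := by
  refine ⟨mul_mem_restrictTotalDegree h.1 h'.1, mul_mem_restrictTotalDegree h.2.1 h'.2.1, ?_⟩
  have e : (A * A' - B * B') * X j = (A - B) * X j * A' + B * ((A' - B') * X j) := by ring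
  rw [e]
  exact Submodule.add_mem _ (mul_mem_restrictTotalDegree h.2.2 h'.1)
    (mul_mem_restrictTotalDegree h.2.1 h'.2.2)

theorem CongrBelow.one (j : Fin n) : CongrBelow j 0 (1 : MvPolynomial (Fin n) k) 1 := by
  refine ⟨?_, ?_, ?_⟩ <;> simp [mem_restrictTotalDegree]

theorem CongrBelow.pow {j : Fin n} {a : ℕ} {A B : MvPolynomial (Fin n) k}
    (h : CongrBelow j a A B) (m : ℕ) : CongrBelow j (m * a) (A ^ m) (B ^ m) := by
  induction m with
  | zero => simpa using CongrBelow.one j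
  | succ m ih =>
    rw [pow_succ, pow_succ, Nat.succ_mul]
    exact ih.mul h

theorem CongrBelow.prod {ι : Type*} {j : Fin n} (s : Finset ι) {a : ι → ℕ}
    {A B : ι → MvPolynomial (Fin n) k} (h : ∀ i, CongrBelow j (a i) (A i) (B i)) :
    CongrBelow j (∑ i ∈ s, a i) (∏ i ∈ s, A i) (∏ i ∈ s, B i) := by
  classical
  induction s using Finset.induction_on with
  | empty => simpa using CongrBelow.one j
  | insert i s hi ih =>
    rw [Finset.sum_insert hi, Finset.prod_insert hi, Finset.prod_insert hi]
    exact (h i).mul ih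

/-- Translating the linear substitution `Q` by constants alters a substituted polynomial of degree
at most `m` only in degrees less than `m`. -/
theorem totalDegree_aeval_add_sub_le {σ : Type*} [Fintype σ] (j : Fin n) {f : MvPolynomial σ k}
    {m : ℕ} (hf : f.totalDegree ≤ m) (P : σ → k) (Q : σ → MvPolynomial (Fin n) k)
    (hQ : ∀ i, (Q i).totalDegree ≤ 1) :
    (aeval (fun i => C (P i) + Q i) f - aeval Q f).totalDegree ≤ m - 1 := by
  have hC : ∀ i, CongrBelow j 1 (C (P i) + Q i) (Q i) := fun i => by
    refine ⟨?_, ?_, ?_⟩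
    · rw [mem_restrictTotalDegree]
      exact (totalDegree_add _ _).trans (by simpa using hQ i)
    · rw [mem_restrictTotalDegree]
      exact hQ i
    · rw [mem_restrictTotalDegree, add_sub_cancel_right]
      exact (totalDegree_mul _ _).trans (by simp)
  have hmem : (aeval (fun i => C (P i) + Q i) f - aeval Q f) * X j ∈
      restrictTotalDegree (Fin n) k m := by
    rw [aeval_def, aeval_def, eval₂_eq', eval₂_eq', ← Finset.sum_sub_distrib, Finset.sum_mul]
    refine Submodule.sum_mem _ fun s hs => ?_
    rw [← mul_sub, mul_assoc, algebraMap_eq, ← smul_eq_C_mul]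
    refine Submodule.smul_mem _ _ (restrictTotalDegree_mono ?_
      (CongrBelow.prod Finset.univ fun i => (hC i).pow (s i)).2.2)
    refine le_trans ?_ ((le_totalDegree hs).trans hf)
    rw [Finsupp.sum_fintype _ _ (by simp)]
    simp
  rw [mem_restrictTotalDegree] at hmem
  by_cases h0 : aeval (fun i => C (P i) + Q i) f - aeval Q f = 0
  · rw [h0, totalDegree_zero]
    exact Nat.zero_le _
  · rw [totalDegree_mul_of_isDomain h0 (X_ne_zero j), totalDegree_X] at hmem
    omega

/-- The plane in `k⁴` with coordinates `z` in the chart of complements of `span {a, b}`. -/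
def graphSpan (a b c e : Fin 4 → k) (z : Fin 4 → k) : Submodule k (Fin 4 → k) :=
  Submodule.span k {c + (z 0 • a + z 1 • b), e + (z 2 • a + z 3 • b)}

/-- The equation on `z` for `s (c + z₀ a + z₁ b) + t (e + z₂ a + z₃ b)` to lie on the surface, with
its leading form removed. -/
noncomputable def graphEquation (f : MvPolynomial (Fin 4) k) (a b c e : Fin 4 → k) (p : k × k) :
    MvPolynomial (Fin 4) k :=
  aeval (fun i => C (p.1 * c i + p.2 * e i) +
      (C (p.1 * a i) * X 0 + C (p.1 * b i) * X 1 + C (p.2 * a i) * X 2 + C (p.2 * b i) * X 3)) f -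
    aeval (fun i => C (p.1 * a i) * X 0 + C (p.1 * b i) * X 1 + C (p.2 * a i) * X 2 +
      C (p.2 * b i) * X 3 : Fin 4 → MvPolynomial (Fin 4) k) f

theorem totalDegree_graphEquation_le {f : MvPolynomial (Fin 4) k} {d : ℕ}
    (hf : f.totalDegree ≤ d) (a b c e : Fin 4 → k) (p : k × k) :
    (graphEquation f a b c e p).totalDegree ≤ d - 1 := by
  refine totalDegree_aeval_add_sub_le 0 hf _ _ fun i => ?_
  have h : ∀ (x : k) (j : Fin 4), (C x * X j : MvPolynomial (Fin 4) k) ∈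
      restrictTotalDegree (Fin 4) k 1 := fun x j => by
    rw [mem_restrictTotalDegree]
    exact (totalDegree_mul _ _).trans (by simp)
  rw [← mem_restrictTotalDegree]
  exact Submodule.add_mem _ (Submodule.add_mem _ (Submodule.add_mem _ (h _ _) (h _ _)) (h _ _))
    (h _ _)

theorem eval_graphEquation {f : MvPolynomial (Fin 4) k} {a b : Fin 4 → k}
    (h : ∀ v ∈ Submodule.span k {a, b}, eval v f = 0) (c e z : Fin 4 → k) (p : k × k) :
    eval z (graphEquation f a b c e p) =
      eval (p.1 • (c + (z 0 • a + z 1 • b)) + p.2 • (e + (z 2 • a + z 3 • b))) f := by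
  have hev : ∀ g : Fin 4 → MvPolynomial (Fin 4) k,
      eval z (aeval g f) = eval (fun i => eval z (g i)) f := fun g => by
    rw [← aeval_eq_eval, ← aeval_eq_eval]
    exact aeval_bind₁ _ _ _
  rw [graphEquation, map_sub, hev, hev]
  have h0 := h _ (Submodule.mem_span_pair.2
    ⟨p.1 * z 0 + p.2 * z 2, p.1 * z 1 + p.2 * z 3, rfl⟩)
  rw [← sub_zero (eval (_ + _) f), ← h0]
  congr 2
  · congr 1
    funext i
    simp
    ring
  · congr 1
    funext i
    simp
    ring

end Skew

section Graph

variable {k : Type*} [Field k] {a b c e : Fin 4 → k}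

theorem linearIndependent_graph
    (hce : ∀ s t : k, s • c + t • e ∈ Submodule.span k {a, b} → s = 0 ∧ t = 0) (z : Fin 4 → k) :
    LinearIndependent k ![c + (z 0 • a + z 1 • b), e + (z 2 • a + z 3 • b)] := by
  rw [LinearIndependent.pair_iff]
  intro s t hst
  refine hce s t (Submodule.mem_span_pair.2
    ⟨-(s * z 0 + t * z 2), -(s * z 1 + t * z 3), ?_⟩)
  rw [← sub_eq_zero, ← neg_eq_zero, ← hst]
  module

theorem isLineOn_graphSpan_iff {f : MvPolynomial (Fin 4) k}
    (hce : ∀ s t : k, s • c + t • e ∈ Submodule.span k {a, b} → s = 0 ∧ t = 0)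
    (h : ∀ v ∈ Submodule.span k {a, b}, eval v f = 0) (z : Fin 4 → k) :
    IsLineOn f (graphSpan a b c e z) ↔ ∀ p, eval z (graphEquation f a b c e p) = 0 := by
  have h2 : Module.finrank k (graphSpan a b c e z) = 2 :=
    finrank_span_pair (linearIndependent_graph hce z)
  simp only [IsLineOn, h2, true_and, eval_graphEquation h]
  constructor
  · exact fun hW p => hW _ (Submodule.mem_span_pair.2 ⟨p.1, p.2, rfl⟩)
  · intro hp v hv
    obtain ⟨s, t, rfl⟩ := Submodule.mem_span_pair.1 hv
    exact hp (s, t)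

theorem eq_zero_of_mem_graphSpan
    (hce : ∀ s t : k, s • c + t • e ∈ Submodule.span k {a, b} → s = 0 ∧ t = 0) {z v : Fin 4 → k}
    (hv : v ∈ graphSpan a b c e z) (hv' : v ∈ Submodule.span k {a, b}) : v = 0 := by
  obtain ⟨s, t, rfl⟩ := Submodule.mem_span_pair.1 hv
  have h1 : s • c + t • e ∈ Submodule.span k {a, b} := by
    have h2 : s • c + t • e = s • (c + (z 0 • a + z 1 • b)) + t • (e + (z 2 • a + z 3 • b)) -
        ((s * z 0 + t * z 2) • a + (s * z 1 + t * z 3) • b) := by module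
    rw [h2]
    exact Submodule.sub_mem _ hv' (Submodule.mem_span_pair.2 ⟨_, _, rfl⟩)
  obtain ⟨rfl, rfl⟩ := hce s t h1
  simp

theorem graphSpan_injective (hab : LinearIndependent k ![a, b])
    (hce : ∀ s t : k, s • c + t • e ∈ Submodule.span k {a, b} → s = 0 ∧ t = 0) :
    Function.Injective (graphSpan a b c e) := by
  intro z z' hzz
  rw [LinearIndependent.pair_iff] at hab
  have key : ∀ {x : Fin 4 → k} {p q p' q' : k},
      x + (p • a + q • b) ∈ graphSpan a b c e z' → x + (p' • a + q' • b) ∈ graphSpan a b c e z' →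
      p = p' ∧ q = q' := by
    intro x p q p' q' h h'
    have h1 := Submodule.sub_mem _ h h'
    have h2 : x + (p • a + q • b) - (x + (p' • a + q' • b)) = (p - p') • a + (q - q') • b := by
      module
    rw [h2] at h1
    have h3 := hab _ _ (eq_zero_of_mem_graphSpan hce h1 (Submodule.mem_span_pair.2 ⟨_, _, rfl⟩))
    exact ⟨sub_eq_zero.1 h3.1, sub_eq_zero.1 h3.2⟩
  have h1 : ∀ w, c + (w 0 • a + w 1 • b) ∈ graphSpan a b c e w := fun w =>
    Submodule.subset_span (by simp)
  have h2 : ∀ w, e + (w 2 • a + w 3 • b) ∈ graphSpan a b c e w := fun w =>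
    Submodule.subset_span (by simp)
  have h3 := key (hzz ▸ h1 z) (h1 z')
  have h4 := key (hzz ▸ h2 z) (h2 z')
  funext i
  fin_cases i
  exacts [h3.1, h3.2, h4.1, h4.2]

theorem exists_graphSpan_eq (hab : LinearIndependent k ![a, b])
    (hce : ∀ s t : k, s • c + t • e ∈ Submodule.span k {a, b} → s = 0 ∧ t = 0)
    {M : Submodule k (Fin 4 → k)} (hM : Module.finrank k M = 2)
    (h : M ⊓ Submodule.span k {a, b} = ⊥) : ∃ z, graphSpan a b c e z = M := by
  have htop := sup_eq_top_of_skew (by simp) hM (finrank_span_pair hab) h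
  have hex : ∀ x : Fin 4 → k, ∃ p q : k, x + (p • a + q • b) ∈ M := by
    intro x
    obtain ⟨m, hm, l, hl, rfl⟩ := Submodule.mem_sup.1 (htop ▸ Submodule.mem_top (x := x))
    obtain ⟨p, q, rfl⟩ := Submodule.mem_span_pair.1 hl
    refine ⟨-p, -q, ?_⟩
    convert hm using 1
    module
  obtain ⟨p, q, hc⟩ := hex c
  obtain ⟨p', q', he⟩ := hex e
  refine ⟨![p, q, p', q'], ?_⟩
  exact (eq_span_pair_of_finrank_eq_two hM hc he
    (linearIndependent_graph hce ![p, q, p', q'])).symm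

/-- If a surface of degree `d` contains finitely many lines, at most `(d - 1) ^ 4` of them are
skew to a given one. -/
theorem card_skew_le [IsAlgClosed k] {f : MvPolynomial (Fin 4) k} {d : ℕ} (hf : f.totalDegree ≤ d)
    (hfin : {W | IsLineOn f W}.Finite) {L : Submodule k (Fin 4 → k)} (hL : IsLineOn f L)
    (Z : Finset (Submodule k (Fin 4 → k))) (hZ : ∀ M ∈ Z, IsLineOn f M ∧ M ⊓ L = ⊥) :
    Z.card ≤ (d - 1) ^ 4 := by
  classical
  obtain ⟨a, b, hab, rfl⟩ := exists_eq_span_pair hL.1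
  obtain ⟨K, hK⟩ := Submodule.exists_isCompl (Submodule.span k {a, b})
  have hK2 : Module.finrank k K = 2 := by
    have := Submodule.finrank_add_eq_of_isCompl hK
    rw [hL.1, Module.finrank_fintype_fun_eq_card, Fintype.card_fin] at this
    omega
  obtain ⟨c, e, hce', rfl⟩ := exists_eq_span_pair hK2
  have hce : ∀ s t : k, s • c + t • e ∈ Submodule.span k {a, b} → s = 0 ∧ t = 0 := fun s t h =>
    LinearIndependent.pair_iff.1 hce' s t
      (Submodule.disjoint_def.1 hK.disjoint _ h (Submodule.mem_span_pair.2 ⟨s, t, rfl⟩))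
  have hinj := graphSpan_injective hab hce
  have hfin' := hfin.preimage (f := graphSpan a b c e) hinj.injOn
  calc Z.card ≤ (hfin'.toFinset.image (graphSpan a b c e)).card := by
        refine Finset.card_le_card fun M hM => ?_
        obtain ⟨z, rfl⟩ := exists_graphSpan_eq hab hce (hZ M hM).1.1 (hZ M hM).2
        exact Finset.mem_image_of_mem _ (hfin'.mem_toFinset.2 (hZ _ hM).1)
    _ ≤ hfin'.toFinset.card := Finset.card_image_le
    _ ≤ (d - 1) ^ 4 := card_common_zeros_le (graphEquation f a b c e)
        (totalDegree_graphEquation_le hf a b c e) _ fun z => by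
          rw [hfin'.mem_toFinset]
          exact isLineOn_graphSpan_iff hce hL.2 z

end Graph

section Counting

variable {k : Type*} [Field k] {f : MvPolynomial (Fin 4) k} {d : ℕ}
  {Λ : Finset (Submodule k (Fin 4 → k))}

open Classical in
/-- The lines of `Λ` other than `W` that meet `W`. -/
noncomputable def meeting (Λ : Finset (Submodule k (Fin 4 → k))) (W : Submodule k (Fin 4 → k)) :
    Finset (Submodule k (Fin 4 → k)) := Λ.filter fun N => N ≠ W ∧ N ⊓ W ≠ ⊥

open Classical in
/-- The lines of `Λ` that are skew to `W`. -/
noncomputable def skewTo (Λ : Finset (Submodule k (Fin 4 → k))) (W : Submodule k (Fin 4 → k)) :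
    Finset (Submodule k (Fin 4 → k)) := Λ.filter fun N => N ⊓ W = ⊥

theorem mem_meeting {N W : Submodule k (Fin 4 → k)} :
    N ∈ meeting Λ W ↔ N ∈ Λ ∧ N ≠ W ∧ N ⊓ W ≠ ⊥ := by
  simp [meeting]

theorem mem_skewTo {N W : Submodule k (Fin 4 → k)} : N ∈ skewTo Λ W ↔ N ∈ Λ ∧ N ⊓ W = ⊥ := by
  simp [skewTo]

theorem IsLineOn.ne_bot {W : Submodule k (Fin 4 → k)} (hW : IsLineOn f W) : W ≠ ⊥ := by
  rintro rfl
  have := hW.1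
  rw [finrank_bot] at this
  omega

theorem card_eq_meeting_add_skewTo (hΛ : ∀ W ∈ Λ, IsLineOn f W) {W : Submodule k (Fin 4 → k)}
    (hW : W ∈ Λ) : Λ.card = 1 + (meeting Λ W).card + (skewTo Λ W).card := by
  classical
  have h1 : Λ = insert W (meeting Λ W) ∪ skewTo Λ W := by
    ext N
    simp only [Finset.mem_union, Finset.mem_insert, mem_meeting, mem_skewTo]
    constructor
    · intro hN
      tauto
    · rintro ((rfl | h) | h)
      exacts [hW, h.1, h.1]
  have h2 : Disjoint (insert W (meeting Λ W)) (skewTo Λ W) := by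
    rw [Finset.disjoint_left]
    intro N hN hN'
    rw [mem_skewTo] at hN'
    rw [Finset.mem_insert, mem_meeting] at hN
    rcases hN with rfl | h
    · rw [inf_idem] at hN'
      exact (hΛ _ hW).ne_bot hN'.2
    · exact h.2.2 hN'.2
  have h3 : W ∉ meeting Λ W := fun h => (mem_meeting.1 h).2.1 rfl
  conv_lhs => rw [h1]
  rw [Finset.card_union_of_disjoint h2, Finset.card_insert_of_notMem h3]
  omega

open Classical in
/-- If `T` meets `L`, all but `d - 1` of the lines meeting `T` are skew to `L`. -/
theorem IsSmoothSurface.card_meeting_le [IsAlgClosed k] (hf : IsSmoothSurface f d) (hd : 2 ≤ d)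
    (hΛ : ∀ W ∈ Λ, IsLineOn f W) {L T : Submodule k (Fin 4 → k)} (hL : L ∈ Λ)
    (hT : T ∈ meeting Λ L) :
    (meeting Λ T).card ≤
      ((skewTo Λ L).filter fun M => M ≠ T ∧ M ⊓ T ≠ ⊥).card + (d - 1) := by
  have : Infinite k := IsAlgClosed.instInfinite
  obtain ⟨hTΛ, hTL, hTL'⟩ := mem_meeting.1 hT
  have hH : Module.finrank k ↥(L ⊔ T) = 3 := by
    have h1 := Submodule.finrank_sup_add_finrank_inf_eq T L
    have h2 := finrank_inf_le_one (hΛ T hTΛ).1 (hΛ L hL).1 hTL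
    have h3 := Submodule.one_le_finrank_iff.2 hTL'
    have h4 := (hΛ T hTΛ).1
    have h5 := (hΛ L hL).1
    rw [sup_comm]
    omega
  have hT' : T ∉ (meeting Λ T).filter fun M => ¬ M ⊓ L = ⊥ := fun h =>
    (mem_meeting.1 (Finset.mem_filter.1 h).1).2.1 rfl
  have hplane := hf.card_lines_in_plane_le hd hH
    (insert T ((meeting Λ T).filter fun M => ¬ M ⊓ L = ⊥)) (by
      intro W hW
      rcases Finset.mem_insert.1 hW with rfl | hW
      · exact ⟨hΛ _ hTΛ, le_sup_right⟩
      · obtain ⟨hWT, hWL⟩ := Finset.mem_filter.1 hW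
        obtain ⟨hWΛ, -, hWT⟩ := mem_meeting.1 hWT
        exact ⟨hΛ W hWΛ,
          hf.le_sup_of_meet (hΛ L hL) (hΛ T hTΛ) (hΛ W hWΛ) hTL.symm hWL hWT⟩)
  rw [Finset.card_insert_of_notMem hT'] at hplane
  rw [← Finset.card_filter_add_card_filter_not (s := meeting Λ T) (fun M => M ⊓ L = ⊥)]
  refine add_le_add (Finset.card_le_card fun M hM => ?_) (by omega)
  obtain ⟨h1, h2⟩ := Finset.mem_filter.1 hM
  obtain ⟨h3, h4⟩ := mem_meeting.1 h1
  exact Finset.mem_filter.2 ⟨mem_skewTo.2 ⟨h3, h2⟩, h4⟩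

end Counting

theorem lines_meeting_two_skew_lines {k : Type*} [Field k] [IsAlgClosed k] (d : ℕ) (hd : 3 < d)
    (f : MvPolynomial (Fin 4) k) (hf : IsSmoothSurface f d)
    (hcount : {W : Submodule k (Fin 4 → k) | IsLineOn f W}.ncard =
      d ^ 2 * (d ^ 2 - 3 * d + 3))
    (L M : Submodule k (Fin 4 → k)) (hL : IsLineOn f L) (hM : IsLineOn f M)
    (hLM : L ≠ M) (hskew : L ⊓ M = ⊥) :
    {N : Submodule k (Fin 4 → k) | IsLineOn f N ∧
        (N ≠ L ∧ N ⊓ L ≠ ⊥) ∧ (N ≠ M ∧ N ⊓ M ≠ ⊥)}.ncard = (d - 1) ^ 2 + 1 := by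
  classical
  have hfin : {W : Submodule k (Fin 4 → k) | IsLineOn f W}.Finite := by
    refine Set.finite_of_ncard_pos ?_
    rw [hcount]
    positivity
  obtain ⟨q, rfl⟩ : ∃ q, d = q + 1 := ⟨d - 1, by omega⟩
  obtain ⟨Λ, hΛ⟩ : ∃ Λ : Finset (Submodule k (Fin 4 → k)), ∀ W, W ∈ Λ ↔ IsLineOn f W :=
    ⟨hfin.toFinset, fun W => hfin.mem_toFinset⟩
  have hcard : Λ.card = q ^ 4 + q ^ 3 + q + 1 := by
    have h1 : {W : Submodule k (Fin 4 → k) | IsLineOn f W} = Λ := by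
      ext W
      exact (hΛ W).symm
    have h2 : (q + 1) ^ 2 - 3 * (q + 1) + 3 + q = q ^ 2 + 1 := by
      have : 3 * (q + 1) ≤ (q + 1) ^ 2 := by nlinarith
      zify [this]
      ring
    rw [h1, Set.ncard_coe_finset] at hcount
    rw [hcount]
    zify at h2 ⊢
    linear_combination ((q : ℤ) + 1) ^ 2 * h2
  have hq : q + 1 - 1 = q := rfl
  have hΛ' := fun W => (hΛ W).1
  have hmeet : ∀ W ∈ Λ, q ^ 3 + q ≤ (meeting Λ W).card := by
    intro W hW
    have h1 := card_eq_meeting_add_skewTo hΛ' hW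
    have h2 := card_skew_le hf.2.1.totalDegree_le hfin (hΛ' W hW) (skewTo Λ W) fun N hN =>
      ⟨hΛ' N (mem_skewTo.1 hN).1, (mem_skewTo.1 hN).2⟩
    rw [hq] at h2
    omega
  have hskew_le : (skewTo Λ L).card ≤ q ^ 4 :=
    card_skew_le hf.2.1.totalDegree_le hfin hL (skewTo Λ L) fun N hN =>
      ⟨hΛ' N (mem_skewTo.1 hN).1, (mem_skewTo.1 hN).2⟩
  have htrans : ∀ N ∈ skewTo Λ L,
      ((meeting Λ L).filter fun T => N ≠ T ∧ N ⊓ T ≠ ⊥).card ≤ q ^ 2 + 1 := by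
    intro N hN
    refine hf.card_transversals_le (by omega) hL (hΛ' N (mem_skewTo.1 hN).1)
      ((inf_comm ..).trans (mem_skewTo.1 hN).2) _ fun T hT => ?_
    obtain ⟨h1, h2⟩ := Finset.mem_filter.1 hT
    obtain ⟨h3, h4⟩ := mem_meeting.1 h1
    exact ⟨hΛ' T h3, h4.2, inf_comm N T ▸ h2.2⟩
  have hset : {N : Submodule k (Fin 4 → k) | IsLineOn f N ∧
      (N ≠ L ∧ N ⊓ L ≠ ⊥) ∧ (N ≠ M ∧ N ⊓ M ≠ ⊥)} =
      ((meeting Λ L).filter fun T => M ≠ T ∧ M ⊓ T ≠ ⊥ :) := by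
    ext N
    rw [Finset.mem_coe, Finset.mem_filter, mem_meeting, hΛ, Set.mem_ofPred_eq, inf_comm M,
      ne_comm (a := M)]
    exact and_assoc.symm
  have hMs : M ∈ skewTo Λ L := mem_skewTo.2 ⟨(hΛ M).2 hM, (inf_comm ..).trans hskew⟩
  rw [hset, Set.ncard_coe_finset, hq]
  refine le_antisymm (htrans M hMs) (not_lt.1 fun hlt => ?_)
  have hdouble := Finset.sum_card_bipartiteAbove_eq_sum_card_bipartiteBelow
    (s := meeting Λ L) (t := skewTo Λ L)
    (fun T N : Submodule k (Fin 4 → k) => N ≠ T ∧ N ⊓ T ≠ ⊥)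
  have hleft : (q ^ 3 + q) * q ^ 3 ≤ ∑ T ∈ meeting Λ L,
      ((skewTo Λ L).filter fun N => N ≠ T ∧ N ⊓ T ≠ ⊥).card := by
    calc (q ^ 3 + q) * q ^ 3 ≤ (meeting Λ L).card * q ^ 3 :=
          Nat.mul_le_mul_right _ (hmeet L ((hΛ L).2 hL))
      _ = ∑ _T ∈ meeting Λ L, q ^ 3 := by rw [Finset.sum_const, smul_eq_mul]
      _ ≤ _ := Finset.sum_le_sum fun T hT => by
          have h1 := hf.card_meeting_le (by omega) hΛ' ((hΛ L).2 hL) hT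
          have h2 := hmeet T (mem_meeting.1 hT).1
          rw [hq] at h1
          omega
  have hright : ∑ N ∈ skewTo Λ L, ((meeting Λ L).filter fun T => N ≠ T ∧ N ⊓ T ≠ ⊥).card <
      q ^ 4 * (q ^ 2 + 1) := by
    calc _ < ∑ _N ∈ skewTo Λ L, (q ^ 2 + 1) := Finset.sum_lt_sum htrans ⟨M, hMs, hlt⟩
      _ = (skewTo Λ L).card * (q ^ 2 + 1) := by rw [Finset.sum_const, smul_eq_mul]
      _ ≤ _ := Nat.mul_le_mul_right _ hskew_le
  have heq : (q ^ 3 + q) * q ^ 3 = q ^ 4 * (q ^ 2 + 1) := by ring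
  rw [heq] at hleft
  exact absurd (hleft.trans_lt (hdouble.trans_lt hright)) (lt_irrefl _)
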